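/- Let ω ∈ T1.3, so ω = C_i(F_k) with 0 ≤ i ≤ f_{k-1}−2. Then the two gaps of ω are: ν_{ω,1} = ε, the empty word (adjacent case), and ν_{ω,2} = (C_i(F_{k-2}))^{-1}, i.e., in the second case consecutive occurrences ω_p and ω_{p+1} overlap in exactly the word C_i(F_{k-2}), so |ν_{ω,2}| = −f_{k-2} < 0. -/

import Mathlib

/-- Finite Fibonacci words: `Fw k = σ^k(a)` where `a = false`, `b = true`,
`σ(a) = ab`, `σ(b) = a`; so `Fw (k+2) = Fw (k+1) ++ Fw k`. -/
def Fw : ℕ → List Bool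
  | 0 => [false]
  | 1 => [false, true]
  | (k+2) => Fw (k+1) ++ Fw k

/-- The infinite Fibonacci word `F_∞` (0-indexed): since `Fw (n+1)` has length
`fib (n+3) > n`, its `n`-th letter is the `n`-th letter of `F_∞`. -/
def fw (n : ℕ) : Bool := (Fw (n+1)).getD n false

/-- Singular words, with index shifted by one: `sw n = s_{n-1}`.
`sw 0 = s_{-1} = a`, and `sw (n+1) = s_n = β_n · F_n · α_n⁻¹` where
`α_n` is the last letter of `F_n` and `β_n` the other letter. -/
def sw : ℕ → List Bool
  | 0 => [false]
  | (n+1) => (!((Fw n).getLastD false)) :: (Fw n).dropLast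

/-- The factor of `F_∞` of length `n` starting at (0-indexed) position `i`. -/
def seg (i n : ℕ) : List Bool := (List.range n).map (fun t => fw (i + t))

/-- `w` occurs in `F_∞` at (0-indexed) position `i`. -/
def OccursAt (w : List Bool) (i : ℕ) : Prop := seg i w.length = w

/-- `w` is a factor of `F_∞`. -/
def IsFactor (w : List Bool) : Prop := ∃ i, OccursAt w i

/-- Starting position of the `(p+1)`-st occurrence of `w` in `F_∞`
(occurrences enumerated by starting position, 0-indexed: `occPos w 0`
is the first occurrence, i.e. the paper's `ω_1`). -/
noncomputable def occPos (w : List Bool) (p : ℕ) : ℕ := Nat.nth (OccursAt w) p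

/-- A finite word viewed as an element of the free group on the alphabet. -/
def listToFree (w : List Bool) : FreeGroup Bool := (w.map FreeGroup.of).prod

/-- The gap `ν_{w,p}` (0-indexed in `p`: `gap w 0` is the paper's `ν_{w,1}`)
between the `(p+1)`-st and `(p+2)`-nd occurrences of `w`, as an element of the
free group: the separating word if the occurrences are separated or adjacent,
and the formal inverse of the overlap if they overlap. -/
noncomputable def gap (w : List Bool) (p : ℕ) : FreeGroup Bool :=
  if occPos w p + w.length ≤ occPos w (p+1) then
    listToFree (seg (occPos w p + w.length) (occPos w (p+1) - (occPos w p + w.length)))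
  else
    (listToFree (seg (occPos w (p+1)) (occPos w p + w.length - occPos w (p+1))))⁻¹

/-- The signed length `|ν_{w,p}|` of the gap (negative in the overlapped case). -/
noncomputable def gapLen (w : List Bool) (p : ℕ) : ℤ :=
  (occPos w (p+1) : ℤ) - ((occPos w p : ℤ) + (w.length : ℤ))

/-- `u` is a singular word (some `s_k`, `k ≥ -1`). -/
def IsSingular (u : List Bool) : Prop := ∃ n, u = sw n

/-- `u` is a singular kernel of `w`: a singular factor of `w` of maximal length. -/
def IsKernelOf (u w : List Bool) : Prop :=
  IsSingular u ∧ u <:+: w ∧ ∀ v : List Bool, IsSingular v → v <:+: w → v.length ≤ u.length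

/-- The excluded words `{ε, ab, ba, aba}`. -/
def excl : List (List Bool) := [[], [false, true], [true, false], [false, true, false]]

/-- The `i`-th conjugate `C_i(w)` (indices taken mod the length). -/
def conj (i : ℕ) (w : List Bool) : List Bool :=
  w.drop (i % w.length) ++ w.take (i % w.length)

/-- `sliceW u i j = u[i,j]`, the letters `i` through `j` of `u`, 1-indexed. -/
def sliceW (u : List Bool) (i j : ℕ) : List Bool := (u.take j).drop (i - 1)

/-! ### Finite Fibonacci words -/

theorem length_Fw (k : ℕ) : (Fw k).length = Nat.fib (k + 2) := by
  induction k using Fw.induct with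
  | case1 => rfl
  | case2 => rfl
  | case3 k ih1 ih2 =>
    rw [Fw, List.length_append, ih1, ih2, Nat.fib_add_two (n := k + 2)]
    exact Nat.add_comm _ _

theorem count_true_Fw (k : ℕ) : (Fw k).count true = Nat.fib k := by
  induction k using Fw.induct with
  | case1 => rfl
  | case2 => rfl
  | case3 k ih1 ih2 =>
    rw [Fw, List.count_append, ih1, ih2, Nat.fib_add_two (n := k)]
    exact Nat.add_comm _ _

theorem Fw_prefix_succ (k : ℕ) : Fw k <+: Fw (k + 1) := by
  cases k with
  | zero => exact ⟨[true], rfl⟩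
  | succ k => exact ⟨Fw k, rfl⟩

theorem Fw_prefix_of_le {m n : ℕ} (h : m ≤ n) : Fw m <+: Fw n := by
  induction n, h using Nat.le_induction with
  | base => exact List.prefix_rfl
  | succ n _ ih => exact ih.trans (Fw_prefix_succ n)

theorem lt_length_Fw (k : ℕ) : k < (Fw k).length := by
  rw [length_Fw]
  induction k with
  | zero => decide
  | succ k ih =>
    have h := Nat.fib_add_two (n := k + 1)
    have h' : 0 < Nat.fib (k + 1) := Nat.fib_pos.2 k.succ_pos
    have h'' : k + 1 + 1 = k + 2 := rfl
    rw [h''] at h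
    omega

/-- `F_{k+1} F_k` and `F_k F_{k+1}` differ exactly by a swap of their last two letters. -/
theorem Fw_near_commute (k : ℕ) : ∃ (G : List Bool) (c : Bool),
    Fw (k + 1) ++ Fw k = G ++ [c, !c] ∧ Fw k ++ Fw (k + 1) = G ++ [!c, c] := by
  induction k with
  | zero => exact ⟨[false], true, rfl, rfl⟩
  | succ k ih =>
    obtain ⟨G, c, h1, h2⟩ := ih
    refine ⟨Fw (k + 1) ++ G, !c, ?_, ?_⟩
    · rw [Fw, List.append_assoc, h2, List.append_assoc, Bool.not_not]
    · rw [Fw, h1, List.append_assoc, Bool.not_not]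

theorem Fw_no_adjacent_true (k : ℕ) :
    (Fw k).IsChain (fun x y => x = true → y = false) := by
  induction k using Fw.induct with
  | case1 => simp [Fw]
  | case2 => simp [Fw]
  | case3 k ih1 ih2 =>
    rw [Fw]
    refine ih1.append ih2 ?_
    intro x _ y hy _
    obtain ⟨t, ht⟩ := Fw_prefix_of_le (Nat.zero_le k)
    rw [← ht] at hy
    simpa [Fw, eq_comm] using hy

/-! ### Factors of the infinite word -/

theorem length_seg (i n : ℕ) : (seg i n).length = n := by simp [seg]

theorem seg_add (i m n : ℕ) : seg i (m + n) = seg i m ++ seg (i + m) n := by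
  simp [seg, List.range_add, Nat.add_assoc]

theorem occursAt_append {u v : List Bool} {j : ℕ} :
    OccursAt (u ++ v) j ↔ OccursAt u j ∧ OccursAt v (j + u.length) := by
  unfold OccursAt
  rw [List.length_append, seg_add]
  exact ⟨fun h => List.append_inj h (length_seg _ _), fun h => by rw [h.1, h.2]⟩

theorem OccursAt.of_prefix {u v : List Bool} {j : ℕ} (h : OccursAt v j) (hu : u <+: v) :
    OccursAt u j := by
  obtain ⟨t, rfl⟩ := hu
  exact (occursAt_append.1 h).1

theorem OccursAt.eq_of_length_eq {u v : List Bool} {j : ℕ} (hu : OccursAt u j)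
    (hv : OccursAt v j) (h : u.length = v.length) : u = v := by
  rw [← hu, ← hv, h]

theorem OccursAt.drop {u : List Bool} {j : ℕ} (h : OccursAt u j) {r : ℕ} (hr : r ≤ u.length) :
    OccursAt (u.drop r) (j + r) := by
  rw [← List.take_append_drop r u, occursAt_append] at h
  simpa [hr] using h.2

theorem occursAt_iff {u : List Bool} {j : ℕ} :
    OccursAt u j ↔ ∀ t (ht : t < u.length), fw (j + t) = u[t] := by
  unfold OccursAt
  constructor
  · intro h t ht
    have := List.getElem_of_eq h (i := t) (by simpa [length_seg] using ht)
    simpa [seg] using this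
  · intro h
    refine List.ext_getElem (length_seg _ _) ?_
    intro t _ ht
    simpa [seg] using h t ht

theorem Fw_occursAt_zero (k : ℕ) : OccursAt (Fw k) 0 := by
  rw [occursAt_iff]
  intro t ht
  have ht' : t < (Fw (t + 1)).length := (Nat.lt_succ_self t).trans (lt_length_Fw (t + 1))
  rw [Nat.zero_add, fw, List.getD_eq_getElem _ _ ht']
  rcases le_total k (t + 1) with h | h
  · exact ((Fw_prefix_of_le h).getElem ht).symm
  · exact (Fw_prefix_of_le h).getElem ht'

theorem seg_zero_prefix_Fw (p : ℕ) : seg 0 p <+: Fw p := by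
  have h := Fw_occursAt_zero p
  obtain ⟨d, hd⟩ := Nat.exists_eq_add_of_lt (lt_length_Fw p)
  rw [OccursAt, hd, Nat.add_assoc, seg_add] at h
  exact ⟨_, h⟩

theorem fw_succ_of_true {p : ℕ} (h : fw p = true) : fw (p + 1) = false := by
  have hc := (Fw_no_adjacent_true (p + 2)).prefix (seg_zero_prefix_Fw (p + 2))
  rw [seg_add] at hc
  have := (List.isChain_append.1 hc).2.1
  simpa [seg, List.range_succ, h] using this

/-- A window of length `|u|` in a prefix of `u u u` is a conjugate of `u`. -/
theorem OccursAt.rotate {u x : List Bool} {j i : ℕ} (h : OccursAt x j)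
    (hx : x <+: u ++ u ++ u) (hi : i + u.length ≤ x.length) :
    OccursAt (u.rotate i) (j + i) := by
  rw [occursAt_iff] at h ⊢
  intro t ht
  rw [List.length_rotate] at ht
  have hlen := hx.length_le
  have hper : ∀ s (hs : s < (u ++ u ++ u).length),
      (u ++ u ++ u)[s] = u[s % u.length]'(Nat.mod_lt _ (by omega)) := by
    intro s hs
    simp only [List.length_append] at hs
    rcases lt_or_ge s u.length with h1 | h1
    · simp [h1, Nat.mod_eq_of_lt]
    rcases lt_or_ge s (u.length + u.length) with h2 | h2
    · have : s % u.length = s - u.length := by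
        rw [Nat.mod_eq_sub_mod h1, Nat.mod_eq_of_lt (by omega)]
      have h3 : s - u.length < u.length := by omega
      simp [List.getElem_append, this, not_lt.2 h1, h3]
    · have : s % u.length = s - (u.length + u.length) := by
        rw [Nat.mod_eq_sub_mod h1, Nat.mod_eq_sub_mod (by omega), Nat.mod_eq_of_lt (by omega)]
        omega
      have h3 : ¬ s - u.length < u.length := by omega
      simp [List.getElem_append, not_lt.2 h1, h3, this, Nat.sub_sub]
  rw [Nat.add_assoc, h (i + t) (by omega), hx.getElem, hper, List.getElem_rotate]
  simp only [Nat.add_comm]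

/-! ### Primitivity -/

theorem count_mul_of_periodic (p : ℕ → Prop) [DecidablePred p] {d : ℕ}
    (h : ∀ t, p (d + t) ↔ p t) (m : ℕ) : Nat.count p (m * d) = m * Nat.count p d := by
  induction m with
  | zero => simp
  | succ m ih =>
    rw [Nat.succ_mul, Nat.add_comm, Nat.count_add]
    simp only [h, ih]
    ring

theorem count_true_eq_count (w : List Bool) :
    Nat.count (fun t => w.getD t false = true) w.length = w.count true := by
  induction w using List.reverseRecOn with
  | nil => simp
  | append_singleton w x ih =>
    rw [List.length_append, List.length_singleton, Nat.count_succ, List.count_append, ← ih]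
    congr 1
    · rw [Nat.count_eq_card_filter_range, Nat.count_eq_card_filter_range]
      congr 1
      refine Finset.filter_congr fun t ht => ?_
      rw [List.getD_append _ _ _ _ (Finset.mem_range.1 ht)]
    · cases x <;> simp

theorem length_dvd_of_rotate_eq_self {w : List Bool} {d : ℕ} (h : w.rotate d = w)
    (hw : Nat.Coprime w.length (w.count true)) : w.length ∣ d := by
  rcases Nat.eq_zero_or_pos w.length with h0 | hpos
  · simp [List.length_eq_zero_iff.1 h0] at hw
  let g : ℕ → Prop := fun t => w.getD (t % w.length) false = true
  have hn : ∀ t, g (w.length + t) ↔ g t := fun t => by simp [g]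
  have hd : ∀ t, g (d + t) ↔ g t := fun t => by
    have hlt : t % w.length < w.length := Nat.mod_lt _ hpos
    have := List.getElem_of_eq h (i := t % w.length) (by simpa using hlt)
    rw [List.getElem_rotate] at this
    simp only [g]
    rw [List.getD_eq_getElem _ _ hlt, List.getD_eq_getElem _ _ (Nat.mod_lt _ hpos), ← this]
    simp [Nat.add_comm d t]
  have hcount : Nat.count g w.length = w.count true := by
    rw [← count_true_eq_count, Nat.count_eq_card_filter_range, Nat.count_eq_card_filter_range]
    congr 1
    refine Finset.filter_congr fun t ht => ?_
    simp only [g, Nat.mod_eq_of_lt (Finset.mem_range.1 ht)]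
  have e1 := count_mul_of_periodic g hn d
  have e2 := count_mul_of_periodic g hd w.length
  rw [Nat.mul_comm d, e2, hcount] at e1
  exact hw.dvd_of_dvd_mul_right (e1 ▸ dvd_mul_right _ _)

theorem Fw_rotate_inj {k r i : ℕ} (hr : r < (Fw k).length) (hi : i < (Fw k).length)
    (h : (Fw k).rotate r = (Fw k).rotate i) : r = i := by
  have hcop : Nat.Coprime (Fw k).length ((Fw k).count true) := by
    rw [length_Fw, count_true_Fw, Nat.fib_add_two, Nat.coprime_self_add_left]
    exact (Nat.fib_coprime_fib_succ k).symm
  have hrot : (Fw k).rotate (r + ((Fw k).length - i)) = Fw k := by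
    rw [← List.rotate_rotate, h, List.rotate_rotate, Nat.add_sub_cancel' hi.le,
      List.rotate_length]
  obtain ⟨q, hq⟩ := length_dvd_of_rotate_eq_self hrot hcop
  have hq1 : q = 1 := by
    have h1 : 0 < q := Nat.pos_of_ne_zero (by rintro rfl; omega)
    have h2 : q < 2 := by
      by_contra! h2
      have := Nat.mul_le_mul_left (Fw k).length h2
      omega
    omega
  subst hq1
  omega

/-! ### The decomposition of the infinite word into blocks -/

/-- The image of a letter under `σ^(K+2)`. -/
def block (K : ℕ) (c : Bool) : List Bool := bif c then Fw (K + 1) else Fw (K + 2)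

/-- The starting position of the `p`-th block of `F_∞ = σ^(K+2)(F_∞)`. -/
def blockPos (K p : ℕ) : ℕ := ((seg 0 p).flatMap (block K)).length

theorem flatMap_block_Fw (K m : ℕ) : (Fw m).flatMap (block K) = Fw (m + (K + 2)) := by
  induction m using Fw.induct with
  | case1 => simp [Fw, block]
  | case2 =>
    rw [Nat.add_comm, show K + 2 + 1 = (K + 1) + 2 from rfl, Fw]
    simp [Fw, block]
  | case3 m ih1 ih2 =>
    rw [Fw, List.flatMap_append, ih1, ih2, show m + 2 + (K + 2) = (m + (K + 2)) + 2 by ring, Fw]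
    congr 2
    ring

theorem blockPos_zero (K : ℕ) : blockPos K 0 = 0 := rfl

theorem flatMap_seg_succ (K p : ℕ) : (seg 0 (p + 1)).flatMap (block K) =
    (seg 0 p).flatMap (block K) ++ block K (fw p) := by
  rw [seg_add, List.flatMap_append]
  simp [seg]

theorem blockPos_succ (K p : ℕ) : blockPos K (p + 1) = blockPos K p + (block K (fw p)).length := by
  rw [blockPos, flatMap_seg_succ, List.length_append, blockPos]

theorem block_occursAt (K p : ℕ) : OccursAt (block K (fw p)) (blockPos K p) := by
  have h : OccursAt ((seg 0 (p + 1)).flatMap (block K)) 0 := by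
    refine (Fw_occursAt_zero (p + 1 + (K + 2))).of_prefix ?_
    rw [← flatMap_block_Fw]
    obtain ⟨t, ht⟩ := seg_zero_prefix_Fw (p + 1)
    exact ⟨t.flatMap (block K), by rw [← ht, List.flatMap_append]⟩
  rw [flatMap_seg_succ, occursAt_append, Nat.zero_add] at h
  exact h.2

theorem blockPos_strictMono (K : ℕ) : StrictMono (blockPos K) := by
  refine strictMono_nat_of_lt_succ fun p => ?_
  rw [blockPos_succ]
  have h1 := lt_length_Fw (K + 1)
  have h2 := lt_length_Fw (K + 2)
  cases fw p <;> simp only [block, cond_true, cond_false] <;> omega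

theorem exists_blockPos_add (K j : ℕ) :
    ∃ p r, r < (block K (fw p)).length ∧ j = blockPos K p + r := by
  have hex : ∃ p, j < blockPos K (p + 1) :=
    ⟨j, (Nat.lt_succ_self j).trans_le ((blockPos_strictMono K).id_le (j + 1))⟩
  classical
  have hlt := Nat.find_spec hex
  have hle : blockPos K (Nat.find hex) ≤ j := by
    rcases hp : Nat.find hex with _ | q
    · simp [blockPos_zero]
    · exact not_lt.1 (Nat.find_min hex (hp ▸ Nat.lt_succ_self q))
  rw [blockPos_succ] at hlt
  exact ⟨Nat.find hex, j - blockPos K (Nat.find hex), by omega, by omega⟩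

theorem blockPos_succ_of_false {K p : ℕ} (h : fw p = false) :
    blockPos K (p + 1) = blockPos K p + (Fw (K + 2)).length := by
  rw [blockPos_succ, h]; rfl

theorem blockPos_succ_of_true {K p : ℕ} (h : fw p = true) :
    blockPos K (p + 1) = blockPos K p + (Fw (K + 1)).length := by
  rw [blockPos_succ, h]; rfl

theorem Fw_succ_occursAt_blockPos (K p : ℕ) : OccursAt (Fw (K + 1)) (blockPos K p) := by
  have h := block_occursAt K p
  cases hp : fw p <;> rw [hp] at h
  · exact h.of_prefix (Fw_prefix_succ (K + 1))
  · exact h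

theorem occursAt_blockPos_of_false {K p : ℕ} (h : fw p = false) :
    OccursAt (Fw (K + 2) ++ Fw (K + 1)) (blockPos K p) := by
  have hb := block_occursAt K p
  rw [h] at hb
  exact occursAt_append.2 ⟨hb, blockPos_succ_of_false h ▸ Fw_succ_occursAt_blockPos K (p + 1)⟩

theorem occursAt_blockPos_of_true {K p : ℕ} (h : fw p = true) :
    OccursAt (Fw (K + 1) ++ Fw (K + 2)) (blockPos K p) := by
  have hb := block_occursAt K p
  have hb' := block_occursAt K (p + 1)
  rw [h] at hb
  rw [fw_succ_of_true h, blockPos_succ_of_true h] at hb'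
  exact occursAt_append.2 ⟨hb, hb'⟩

theorem Fw_append_prefix (K : ℕ) :
    Fw (K + 2) ++ Fw (K + 1) <+: Fw (K + 2) ++ Fw (K + 2) ++ Fw (K + 2) := by
  rw [List.append_assoc, List.prefix_append_right_inj]
  exact (Fw_prefix_succ (K + 1)).trans (List.prefix_append _ _)

theorem two_le_length_Fw_succ (K : ℕ) : 2 ≤ (Fw (K + 1)).length := by
  have := lt_length_Fw (K + 1)
  omega

theorem occursAt_conj_iff {K i : ℕ} (h : i + 2 ≤ (Fw (K + 1)).length) (j : ℕ) :
    OccursAt ((Fw (K + 2)).rotate i) j ↔ ∃ p, j = blockPos K p + i := by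
  obtain ⟨G, c, h1, h2⟩ := Fw_near_commute (K + 1)
  have hlen : (Fw (K + 2)).length + (Fw (K + 1)).length = G.length + 2 := by
    simpa using congrArg List.length h1
  have hle : (Fw (K + 1)).length ≤ (Fw (K + 2)).length := (Fw_prefix_succ (K + 1)).length_le
  have hGc : G ++ [c] <+: Fw (K + 2) ++ Fw (K + 1) := ⟨[!c], by simp [h1]⟩
  have hGpre : G <+: Fw (K + 2) ++ Fw (K + 1) := ⟨[c, !c], h1.symm⟩
  have hG : ∀ p, OccursAt G (blockPos K p) := fun p => by
    cases hp : fw p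
    · exact (occursAt_blockPos_of_false hp).of_prefix hGpre
    · exact (occursAt_blockPos_of_true hp).of_prefix ⟨[!c, c], h2.symm⟩
  constructor
  · intro hj
    obtain ⟨p, r, hr, rfl⟩ := exists_blockPos_add K j
    refine ⟨p, ?_⟩
    cases hp : fw p <;> rw [hp] at hr
    · change r < (Fw (K + 2)).length at hr
      have hFG : Fw (K + 2) <+: G :=
        List.prefix_of_prefix_length_le (List.prefix_append _ _) hGpre
          (by have := two_le_length_Fw_succ K; omega)
      have hsq : OccursAt (Fw (K + 2) ++ Fw (K + 2)) (blockPos K p) :=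
        occursAt_append.2 ⟨(occursAt_blockPos_of_false hp).of_prefix (List.prefix_append _ _),
          blockPos_succ_of_false hp ▸ (hG (p + 1)).of_prefix hFG⟩
      have hrot := hsq.rotate (u := Fw (K + 2)) (i := r) (List.prefix_append _ _)
        (by rw [List.length_append]; omega)
      rw [Fw_rotate_inj hr (by omega) (hrot.eq_of_length_eq hj (by simp))]
    · change r < (Fw (K + 1)).length at hr
      rcases Nat.lt_or_ge (r + 1) (Fw (K + 1)).length with hr' | hr'
      · have hrot := (hG p).rotate (u := Fw (K + 2)) (i := r)
          (hGpre.trans (Fw_append_prefix K)) (by omega)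
        rw [Fw_rotate_inj (by omega) (by omega) (hrot.eq_of_length_eq hj (by simp))]
      · exfalso
        have hocc : OccursAt (G ++ [c]) 0 := by
          have := occursAt_blockPos_of_false (K := K) (p := 0) rfl
          rw [blockPos_zero] at this
          exact this.of_prefix hGc
        have hrot := hocc.rotate (u := Fw (K + 2)) (i := r)
          (hGc.trans (Fw_append_prefix K)) (by simp; omega)
        have e1 := hrot.eq_of_length_eq (hocc.drop (r := r) (by simp; omega)) (by simp; omega)
        have hocc' : OccursAt (G ++ [!c]) (blockPos K p) :=
          (occursAt_blockPos_of_true hp).of_prefix ⟨[c], by simp [h2]⟩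
        have e2 := hj.eq_of_length_eq (hocc'.drop (r := r) (by simp; omega)) (by simp; omega)
        have c1 := ((Fw (K + 2)).rotate_perm r).count_eq true
        have c2 := ((Fw (K + 2)).rotate_perm i).count_eq true
        rw [e1, List.drop_append_of_le_length (by omega), List.count_append] at c1
        rw [e2, List.drop_append_of_le_length (by omega), List.count_append, ← c1] at c2
        cases c <;> simp at c2
  · rintro ⟨p, rfl⟩
    exact (hG p).rotate (hGpre.trans (Fw_append_prefix K)) (by omega)

theorem occPos_conj {K i : ℕ} (h : i + 2 ≤ (Fw (K + 1)).length) (p : ℕ) :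
    occPos ((Fw (K + 2)).rotate i) p = blockPos K p + i := by
  have hmono : StrictMono fun p => blockPos K p + i := (blockPos_strictMono K).add_const i
  have hrange : Set.ofPred (OccursAt ((Fw (K + 2)).rotate i)) =
      Set.range fun p => blockPos K p + i := by
    ext j
    exact (occursAt_conj_iff h j).trans (exists_congr fun _ => eq_comm)
  have hinf : (Set.ofPred (OccursAt ((Fw (K + 2)).rotate i))).Infinite :=
    hrange ▸ Set.infinite_range_of_injective hmono.injective
  have := (StrictMono.range_inj (Nat.nth_strictMono hinf) hmono).1
    ((Nat.range_nth_of_infinite hinf).trans hrange)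
  exact congrFun this p

theorem conj_eq_rotate (i : ℕ) (w : List Bool) : conj i w = w.rotate i :=
  List.rotate_eq_drop_append_take_mod.symm

theorem Fw_rotate_occursAt {K i j : ℕ} (h : i + 2 ≤ (Fw (K + 1)).length)
    (hj : OccursAt (Fw (K + 2)) j) : OccursAt ((Fw K).rotate i) (j + i) := by
  cases K with
  | zero =>
    obtain rfl : i = 0 := by simpa [Fw] using h
    exact hj.of_prefix ⟨[true, false], rfl⟩
  | succ K =>
    obtain ⟨G, c, h1, h2⟩ := Fw_near_commute K
    have hF : Fw (K + 1 + 2) = Fw (K + 1) ++ G ++ [!c, c] := by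
      rw [Fw, Fw, List.append_assoc, h2, List.append_assoc]
    have hG : OccursAt (Fw (K + 1) ++ G) j := hj.of_prefix ⟨[!c, c], hF.symm⟩
    have hlen : (Fw (K + 1)).length + (Fw K).length = G.length + 2 := by
      simpa using congrArg List.length h1
    refine hG.rotate ?_ ?_
    · rw [List.append_assoc, List.prefix_append_right_inj]
      have hpre : G <+: Fw (K + 1) ++ Fw K := ⟨[c, !c], h1.symm⟩
      exact hpre.trans ((List.prefix_append_right_inj _).2 (Fw_prefix_succ K))
    · rw [show Fw (K + 1 + 1) = Fw (K + 1) ++ Fw K from rfl, List.length_append] at h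
      rw [List.length_append]
      omega

/-- let `ω ∈ T1.3`, i.e. `ω = C_i(F_k)` with `0 ≤ i ≤ f_{k-1}-2`.
Then `ν_{ω,1} = ε` (for `p` with `F_∞[p] = a`, consecutive occurrences are adjacent),
and `ν_{ω,2} = (C_i(F_{k-2}))⁻¹` (for `p` with `F_∞[p] = b`, consecutive occurrences
overlap in exactly the word `C_i(F_{k-2})` of length `f_{k-2}`, so `|ν_{ω,2}| = -f_{k-2}`). -/
theorem stmt16 (k i : ℕ) (h : i + 2 ≤ Nat.fib (k+1)) :
    gap (conj i (Fw k)) 0 = 1 ∧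
    gap (conj i (Fw k)) 1 = (listToFree (conj i (Fw (k-2))))⁻¹ ∧
    (∀ p : ℕ, fw p = false →
      occPos (conj i (Fw k)) (p+1)
        = occPos (conj i (Fw k)) p + (conj i (Fw k)).length) ∧
    (∀ p : ℕ, fw p = true →
      occPos (conj i (Fw k)) (p+1) + Nat.fib k
        = occPos (conj i (Fw k)) p + (conj i (Fw k)).length) := by
  obtain ⟨K, rfl⟩ : ∃ K, k = K + 2 := by
    match k, h with
    | 0, h => simp at h
    | 1, h => simp at h
    | K + 2, _ => exact ⟨K, rfl⟩
  have hi : i + 2 ≤ (Fw (K + 1)).length := by rwa [length_Fw]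
  have hlen : (Fw (K + 1)).length + (Fw K).length = (Fw (K + 2)).length := by
    rw [Fw, List.length_append]
  have hfib : Nat.fib (K + 2) = (Fw K).length := (length_Fw K).symm
  rw [Nat.add_sub_cancel, conj_eq_rotate, conj_eq_rotate]
  have hfalse : ∀ p, fw p = false → occPos ((Fw (K + 2)).rotate i) (p + 1) =
      occPos ((Fw (K + 2)).rotate i) p + ((Fw (K + 2)).rotate i).length := fun p hp => by
    rw [occPos_conj hi, occPos_conj hi, blockPos_succ_of_false hp, List.length_rotate]
    ring
  have htrue : ∀ p, fw p = true → occPos ((Fw (K + 2)).rotate i) (p + 1) + Nat.fib (K + 2) =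
      occPos ((Fw (K + 2)).rotate i) p + ((Fw (K + 2)).rotate i).length := fun p hp => by
    rw [occPos_conj hi, occPos_conj hi, blockPos_succ_of_true hp, List.length_rotate, hfib]
    omega
  refine ⟨?_, ?_, hfalse, htrue⟩
  · rw [gap, if_pos (hfalse 0 rfl).ge, hfalse 0 rfl, Nat.sub_self]
    simp [seg, listToFree]
  · have h1 := htrue 1 rfl
    have hpos : 0 < Nat.fib (K + 2) := Nat.fib_pos.2 (Nat.succ_pos _)
    rw [gap, if_neg (by omega), ← h1, Nat.add_sub_cancel_left, occPos_conj hi, hfib]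
    have hocc := Fw_rotate_occursAt hi
      ((occursAt_blockPos_of_false (K := K) (p := 2) rfl).of_prefix (List.prefix_append _ _))
    rw [OccursAt, List.length_rotate] at hocc
    rw [hocc]
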